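/- arXiv:1701.00346 — 3 statements merged into one kernel-verified Lean document; each statement's English description precedes it below -/
import Mathlib

section
/- Let t > 1 be a real number and let a, b be natural numbers. Then M_{2a+b,b}(t) ≥ t^{(2a+b)²/2 − a²}. -/
noncomputable section

open Finset

/-- Height of the path `w` (of length `L`, up = `true`, down = `false`) after `i` steps. -/
def height {L : ℕ} (w : Fin L → Bool) (i : ℕ) : ℤ :=
  ∑ j ∈ Finset.univ.filter (fun j : Fin L => (j : ℕ) < i),
    (if w j then (1 : ℤ) else -1)

/-- `DyckSet a b`: the set `D_{a,b}` of paths of length `2a+b` with `a+b` up steps whose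
heights stay nonnegative. -/
def DyckSet (a b : ℕ) : Finset (Fin (2 * a + b) → Bool) :=
  Finset.univ.filter (fun w =>
    (Finset.univ.filter (fun j => w j = true)).card = a + b ∧
      ∀ i ≤ 2 * a + b, 0 ≤ height w i)

/-- The area `A(w)` between the path `w` and the x-axis. -/
def area {L : ℕ} (w : Fin L → Bool) : ℝ :=
  (∑ i ∈ Finset.range L, ((height w i + height w (i + 1) : ℤ) : ℝ)) / 2

/-- The weighted path sum `M_{2a+b,b}(t) = Σ_{w ∈ D_{a,b}} t^{A(w)}`. -/
def M (a b : ℕ) (t : ℝ) : ℝ := ∑ w ∈ DyckSet a b, t ^ area w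

/-- `M_{ℓ,m}(t)` for `ℓ ≥ m` with `ℓ - m` even. -/
def Mlm (ℓ m : ℕ) (t : ℝ) : ℝ := M ((ℓ - m) / 2) m t

/-- `P k`: the number of partitions of `k`. -/
def P (k : ℕ) : ℕ := Fintype.card (Nat.Partition k)

/-- `C(t) = Σ_{k=0}^∞ P(k) t^{-2k}`. -/
def C (t : ℝ) : ℝ := ∑' k : ℕ, (P k : ℝ) * t ^ (-(2 : ℝ) * k)

lemma height_zero {L : ℕ} (w : Fin L → Bool) : height w 0 = 0 := by
  simp [height]

lemma height_succ {L : ℕ} (w : Fin L → Bool) {i : ℕ} (hi : i < L) :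
    height w (i + 1) = height w i + if w ⟨i, hi⟩ then (1 : ℤ) else -1 := by
  have h : Finset.univ.filter (fun j : Fin L => (j : ℕ) < i + 1) =
      insert ⟨i, hi⟩ (Finset.univ.filter (fun j : Fin L => (j : ℕ) < i)) := by
    ext j
    simp only [mem_filter, mem_univ, true_and, mem_insert, Fin.ext_iff]
    omega
  rw [height, h, sum_insert (by simp), add_comm, height]

/-- The path of length `L` made of `c` up steps followed by down steps only. -/
def peakPath (L c : ℕ) : Fin L → Bool := fun j => decide ((j : ℕ) < c)

lemma height_peakPath (L c : ℕ) {i : ℕ} (hi : i ≤ L) :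
    height (peakPath L c) i = if i ≤ c then (i : ℤ) else 2 * c - i := by
  induction i with
  | zero => simp [height_zero]
  | succ k ih =>
    rw [height_succ _ (by omega : k < L), ih (by omega)]
    simp only [peakPath, decide_eq_true_eq]
    push_cast
    split_ifs <;> omega

lemma sum_height_peakPath (L c : ℕ) {n : ℕ} (hn : n ≤ L) :
    ∑ i ∈ Finset.range n, (height (peakPath L c) i + height (peakPath L c) (i + 1)) =
      if n ≤ c then (n : ℤ) ^ 2 else 2 * (c : ℤ) ^ 2 - (2 * c - n) ^ 2 := by
  induction n with
  | zero => simp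
  | succ k ih =>
    rw [sum_range_succ, ih (by omega), height_peakPath L c (by omega), height_peakPath L c hn]
    rcases lt_trichotomy k c with h | rfl | h
    · simp only [h.le, Nat.succ_le_of_lt h, if_true]
      push_cast
      ring
    · simp only [le_refl, Nat.not_succ_le_self, if_true, if_false]
      push_cast
      ring
    · simp only [h.not_ge, (h.trans (Nat.lt_succ_self k)).not_ge, if_false]
      push_cast
      ring

lemma area_peakPath (a b : ℕ) :
    area (peakPath (2 * a + b) (a + b)) =
      ((2 * a + b : ℕ) : ℝ) ^ 2 / 2 - (a : ℝ) ^ 2 := by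
  rw [area, ← Int.cast_sum, sum_height_peakPath _ _ le_rfl]
  split_ifs with h
  · obtain rfl : a = 0 := by omega
    simp
  · push_cast
    ring

lemma peakPath_mem_DyckSet (a b : ℕ) : peakPath (2 * a + b) (a + b) ∈ DyckSet a b := by
  simp only [DyckSet, mem_filter, mem_univ, true_and]
  refine ⟨?_, fun i hi => ?_⟩
  · simp only [peakPath, decide_eq_true_eq]
    rw [Fin.card_filter_val_lt]
    omega
  · rw [height_peakPath _ _ hi]
    push_cast
    split_ifs <;> omega

/-- Lemma 1 (lower bound): for `t > 1`, `M_{2a+b,b}(t) ≥ t^{(2a+b)²/2 - a²}`. -/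
theorem stmt_0 (t : ℝ) (ht : 1 < t) (a b : ℕ) :
    t ^ (((2 * a + b : ℕ) : ℝ) ^ 2 / 2 - (a : ℝ) ^ 2) ≤ M a b t := by
  rw [← area_peakPath, M]
  exact single_le_sum (f := fun w => t ^ area w)
    (fun w _ => Real.rpow_nonneg (by linarith) _) (peakPath_mem_DyckSet a b)
end
end

section
/- Let a, b, k be natural numbers. The number of paths w ∈ D_{a,b} with A(w) = (2a+b)²/2 − a² − 2k is at most P(k), the number of partitions of k. -/
noncomputable section

open Finset

/-- Lowering the `i`-th value of a strictly increasing function by `i` keeps it monotone. -/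
theorem monotoneOn_sub_id {f : ℕ → ℕ} {a : ℕ} (hf : StrictMonoOn f (Set.Iio a)) :
    MonotoneOn (fun i => f i - i) (Set.Iio a) := by
  have key : ∀ d i, i + d < a → f i + d ≤ f (i + d) := by
    intro d
    induction d with
    | zero => simp
    | succ d ih =>
      intro i hi
      have h₁ := ih i (by omega)
      have h₂ : f (i + d) < f (i + d + 1) :=
        hf (show i + d < a by omega) (show i + d + 1 < a by omega) (Nat.lt_succ_self _)
      show f i + (d + 1) ≤ f (i + d + 1)
      omega
  intro i _ j hj hij
  obtain ⟨d, rfl⟩ := Nat.exists_eq_add_of_le hij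
  have := key d i hj
  show f i - i ≤ f (i + d) - (i + d)
  omega

theorem le_of_strictMonoOn_Iio {f : ℕ → ℕ} {a : ℕ} (hf : StrictMonoOn f (Set.Iio a)) :
    ∀ i < a, i ≤ f i := by
  intro i
  induction i with
  | zero => simp
  | succ i ih =>
    intro hi
    have h₁ := ih (by omega)
    have h₂ : f i < f (i + 1) := hf (show i < a by omega) hi (Nat.lt_succ_self _)
    omega

/-- Functions that are monotone on an initial segment and take the same values there with
multiplicity agree on it. -/
theorem eqOn_of_monotoneOn_of_map_range_eq {f g : ℕ → ℕ} {a : ℕ}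
    (hf : MonotoneOn f (Set.Iio a)) (hg : MonotoneOn g (Set.Iio a))
    (h : (Multiset.range a).map f = (Multiset.range a).map g) :
    Set.EqOn f g (Set.Iio a) := by
  have sorted : ∀ {u : ℕ → ℕ}, MonotoneOn u (Set.Iio a) →
      ((List.range a).map u).Pairwise (· ≤ ·) := by
    intro u hu
    rw [List.pairwise_map]
    refine List.pairwise_lt_range.imp_of_mem ?_
    intro i j hi hj hij
    exact hu (List.mem_range.1 hi) (List.mem_range.1 hj) hij.le
  have hp : ((List.range a).map f).Perm ((List.range a).map g) := Multiset.coe_eq_coe.1 h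
  have he := hp.eq_of_pairwise (fun _ _ _ _ => le_antisymm) (sorted hf) (sorted hg)
  intro i hi
  exact List.map_inj_left.1 he i (List.mem_range.2 hi)

/-- Multisets of natural numbers of equal size with the same nonzero elements are equal. -/
theorem Multiset.eq_of_filter_ne_zero_eq {s t : Multiset ℕ} (hc : s.card = t.card)
    (h : s.filter (· ≠ 0) = t.filter (· ≠ 0)) : s = t := by
  have aux : ∀ u : Multiset ℕ,
      u = Multiset.replicate (u.card - (u.filter (· ≠ 0)).card) 0 + u.filter (· ≠ 0) := by
    intro u
    have h₁ := Multiset.filter_add_not (fun x : ℕ => x = 0) u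
    have h₂ : u.filter (fun x => x = 0) = Multiset.replicate (u.count 0) 0 :=
      Multiset.filter_eq' u 0
    have h₃ := congrArg Multiset.card h₁
    rw [h₂, Multiset.card_add, Multiset.card_replicate] at h₃
    rw [h₂] at h₁
    have h₄ : u.card - (u.filter (· ≠ 0)).card = u.count 0 := by
      simp only [ne_eq]; omega
    rw [h₄]
    exact h₁.symm
  rw [aux s, aux t, hc, h]

theorem Multiset.sum_filter_ne_zero (s : Multiset ℕ) : (s.filter (· ≠ 0)).sum = s.sum := by
  induction s using Multiset.induction_on with
  | empty => rfl
  | cons x s ih =>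
    by_cases hx : x = 0
    · rw [Multiset.filter_cons_of_neg (p := (· ≠ 0)) _ (not_not.2 hx), Multiset.sum_cons, ih, hx, zero_add]
    · rw [Multiset.filter_cons_of_pos (p := (· ≠ 0)) _ hx, Multiset.sum_cons, Multiset.sum_cons, ih]

/-- The nonzero parts of the partition attached to the finite set `s₀ < s₁ < ⋯`, namely the
nonzero differences `sᵢ - i`. -/
def shiftedParts (S : Finset ℕ) : Multiset ℕ :=
  ((Multiset.range S.card).map (fun i => Nat.nth (· ∈ S) i - i)).filter (· ≠ 0)

theorem Finset.strictMonoOn_nth_mem (S : Finset ℕ) :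
    StrictMonoOn (Nat.nth (· ∈ S)) (Set.Iio S.card) := by
  have h := Nat.nth_strictMonoOn (p := (· ∈ S)) S.finite_toSet
  simpa using h

theorem Finset.image_nth_mem (S : Finset ℕ) :
    (Finset.range S.card).image (Nat.nth (· ∈ S)) = S := by
  have h := Nat.image_nth_Iio_card (p := (· ∈ S)) S.finite_toSet
  apply Finset.coe_injective
  simpa using h

theorem shiftedParts_sum (S : Finset ℕ) :
    2 * (shiftedParts S).sum + S.card ^ 2 = ∑ s ∈ S, (2 * s + 1) := by
  have hmono := S.strictMonoOn_nth_mem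
  have h₁ : (shiftedParts S).sum = ∑ i ∈ Finset.range S.card, (Nat.nth (· ∈ S) i - i) := by
    exact Multiset.sum_filter_ne_zero _
  have h₂ : ∑ s ∈ S, s = ∑ i ∈ Finset.range S.card, Nat.nth (· ∈ S) i := by
    conv_lhs => rw [← S.image_nth_mem]
    rw [Finset.sum_image]
    simpa using hmono.injOn
  have h₃ : ∑ i ∈ Finset.range S.card, (Nat.nth (· ∈ S) i - i) + ∑ i ∈ Finset.range S.card, i =
      ∑ i ∈ Finset.range S.card, Nat.nth (· ∈ S) i := by
    rw [← Finset.sum_add_distrib]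
    refine Finset.sum_congr rfl fun i hi => Nat.sub_add_cancel ?_
    exact le_of_strictMonoOn_Iio hmono i (Finset.mem_range.1 hi)
  have h₄ := Finset.sum_range_id_mul_two S.card
  have h₅ : S.card * (S.card - 1) + S.card = S.card ^ 2 := by
    cases S.card <;> simp; ring
  rw [Finset.sum_add_distrib, ← Finset.mul_sum, Finset.sum_const, smul_eq_mul, mul_one]
  omega

theorem shiftedParts_injOn (a : ℕ) : Set.InjOn shiftedParts {S : Finset ℕ | S.card = a} := by
  intro S hS T hT h
  simp only [Set.mem_ofPred_eq] at hS hT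
  have hSm := S.strictMonoOn_nth_mem
  have hTm := T.strictMonoOn_nth_mem
  have hSi := S.image_nth_mem
  have hTi := T.image_nth_mem
  unfold shiftedParts at h
  rw [hS] at hSm hSi h
  rw [hT] at hTm hTi h
  have he := eqOn_of_monotoneOn_of_map_range_eq (monotoneOn_sub_id hSm) (monotoneOn_sub_id hTm)
    (Multiset.eq_of_filter_ne_zero_eq (by simp) h)
  rw [← hSi, ← hTi]
  refine Finset.image_congr fun i hi => ?_
  have hi' : i < a := by simpa using hi
  have h₁ := le_of_strictMonoOn_Iio hSm i hi'
  have h₂ := le_of_strictMonoOn_Iio hTm i hi'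
  have h₃ : Nat.nth (· ∈ S) i - i = Nat.nth (· ∈ T) i - i := he hi'
  omega

/-- The down steps of a path, indexed by the number of steps that follow them. -/
def downSteps {L : ℕ} (w : Fin L → Bool) : Finset ℕ :=
  (Finset.univ.filter (fun j : Fin L => w j.rev = false)).map Fin.valEmbedding

theorem downSteps_injective {L : ℕ} :
    Function.Injective (downSteps : (Fin L → Bool) → Finset ℕ) := by
  intro v w h
  have h' := Finset.map_injective _ h
  funext j
  have hj := Finset.ext_iff.1 h' j.rev
  simp only [Finset.mem_filter, Finset.mem_univ, true_and, Fin.rev_rev] at hj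
  cases hv : v j <;> cases hw : w j <;> simp_all

theorem sum_downSteps {L : ℕ} (w : Fin L → Bool) (f : ℕ → ℕ) :
    ∑ s ∈ downSteps w, f s = ∑ j : Fin L, if w j then 0 else f (L - 1 - j) := by
  rw [downSteps, Finset.sum_map, Finset.sum_filter, ← Equiv.sum_comp Fin.revPerm]
  refine Finset.sum_congr rfl fun j _ => ?_
  have hj : L - (j + 1) = L - 1 - (j : ℕ) := by omega
  cases h : w j <;> simp [h, Fin.val_rev, hj]

theorem card_downSteps {L : ℕ} (w : Fin L → Bool) :
    (downSteps w).card + (Finset.univ.filter (fun j => w j = true)).card = L := by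
  rw [Finset.card_eq_sum_ones, sum_downSteps, Finset.card_filter, ← Finset.sum_add_distrib]
  refine (Finset.sum_congr rfl fun j _ => ?_).trans (Fin.sum_const L 1) |>.trans (by simp)
  cases w j <;> simp

theorem sum_indicator_lt (L j : ℕ) (hj : j < L) :
    ∑ i ∈ Finset.range L, ((if j < i then (1 : ℤ) else 0) + if j < i + 1 then 1 else 0) =
      2 * (L - 1 - j : ℕ) + 1 := by
  induction L with
  | zero => omega
  | succ L ih =>
    rw [Finset.sum_range_succ]
    rcases Nat.lt_succ_iff_lt_or_eq.1 hj with h | rfl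
    · rw [ih h, if_pos h, if_pos hj]
      omega
    · rw [Finset.sum_eq_zero]
      · simp
      · intro i hi
        have := Finset.mem_range.1 hi
        rw [if_neg (by omega), if_neg (by omega), add_zero]

theorem sum_odd_rev (L : ℕ) : ∑ j : Fin L, (2 * ((L - 1 - (j : ℕ) : ℕ) : ℤ) + 1) = (L : ℤ) ^ 2 := by
  rw [Fin.sum_univ_eq_sum_range (fun j => 2 * ((L - 1 - j : ℕ) : ℤ) + 1),
    Finset.sum_range_reflect (fun j => 2 * (j : ℤ) + 1)]
  induction L with
  | zero => simp
  | succ L ih => rw [Finset.sum_range_succ, ih]; push_cast; ring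

/-- Twice the area of a path, as an integer. -/
theorem sum_height_add_height {L : ℕ} (w : Fin L → Bool) :
    ∑ i ∈ Finset.range L, (height w i + height w (i + 1)) =
      (L : ℤ) ^ 2 - 2 * (∑ s ∈ downSteps w, (2 * s + 1) : ℕ) := by
  have h₁ : ∑ i ∈ Finset.range L, (height w i + height w (i + 1)) =
      ∑ j : Fin L, (if w j then (1 : ℤ) else -1) * (2 * (L - 1 - (j : ℕ) : ℕ) + 1) := by
    simp only [height, Finset.sum_filter, ← Finset.sum_add_distrib]
    rw [Finset.sum_comm]
    refine Finset.sum_congr rfl fun j _ => ?_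
    rw [← sum_indicator_lt L j j.2, Finset.mul_sum]
    refine Finset.sum_congr rfl fun i _ => ?_
    split_ifs <;> simp
  rw [h₁, sum_downSteps, ← sum_odd_rev, Nat.cast_sum, Finset.mul_sum, ← Finset.sum_sub_distrib]
  refine Finset.sum_congr rfl fun j _ => ?_
  cases w j <;> simp; ring

theorem area_eq {L : ℕ} (w : Fin L → Bool) :
    area w = (L : ℝ) ^ 2 / 2 - (downSteps w).card ^ 2 - 2 * (shiftedParts (downSteps w)).sum := by
  rw [area, ← Int.cast_sum, sum_height_add_height, ← shiftedParts_sum]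
  generalize (shiftedParts (downSteps w)).sum = n
  push_cast
  ring

open scoped Classical in
/-- The number of paths in `D_{a,b}` of area `(2a+b)²/2 - a² - 2k` is at most `P(k)`. -/
theorem stmt_6 (a b k : ℕ) :
    ((DyckSet a b).filter
        (fun w => area w = ((2 * a + b : ℕ) : ℝ) ^ 2 / 2 - (a : ℝ) ^ 2 - 2 * k)).card
      ≤ P k := by
  have hcard : ∀ w ∈ DyckSet a b, (downSteps w).card = a := by
    intro w hw
    have h₁ := (Finset.mem_filter.1 hw).2.1
    have h₂ := card_downSteps w
    omega
  refine (Finset.card_le_card_of_injOn (t := Finset.univ.image (Nat.Partition.parts (n := k)))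
    (fun w => shiftedParts (downSteps w)) ?_ ?_).trans Finset.card_image_le
  · intro w hw
    obtain ⟨hw, harea⟩ := Finset.mem_filter.1 hw
    rw [area_eq, hcard w hw] at harea
    have hsum : (shiftedParts (downSteps w)).sum = k := by
      have : ((shiftedParts (downSteps w)).sum : ℝ) = k := by linarith
      exact_mod_cast this
    refine Finset.mem_coe.2 (Finset.mem_image.2 ⟨⟨shiftedParts (downSteps w), ?_, hsum⟩,
      Finset.mem_univ _, rfl⟩)
    intro i hi
    exact Nat.pos_of_ne_zero (Multiset.mem_filter.1 hi).2
  · intro v hv w hw h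
    exact downSteps_injective (shiftedParts_injOn a (hcard v (Finset.mem_filter.1 hv).1)
      (hcard w (Finset.mem_filter.1 hw).1) h)
end
end

section
/- Let t > 1 be a real number, let n ≥ 1 and 1 ≤ j ≤ n be integers, and define the mean height at the cut j by ⟨m_j⟩ := Σ_m m · M_{j,m}(t) M_{2n−j,m}(t) / M_{2n,0}(t), the sum running over natural numbers m ≤ j with j − m even. Then 0 ≤ j − ⟨m_j⟩ < 2 C(t)² Σ_{N'=0}^∞ N' t^{−2N'² − 2(n−j)N'}; in particular j − ⟨m_j⟩ < 2 C(t)² Σ_{N'=0}^∞ N' t^{−2N'²}. -/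
noncomputable section

open Finset

/-- The number of partitions of `k` all of whose parts are at most `u`. -/
def boundedPartitionCount (u k : ℕ) : ℕ :=
  (univ.filter (fun p : Nat.Partition k => ∀ i ∈ p.parts, i ≤ u)).card

lemma boundedPartitionCount_le_P (u k : ℕ) : boundedPartitionCount u k ≤ P k :=
  Finset.card_le_univ _

lemma boundedPartitionCount_eq_P {u k : ℕ} (h : k ≤ u) : boundedPartitionCount u k = P k := by
  unfold boundedPartitionCount P
  rw [Finset.filter_true_of_mem, Finset.card_univ]
  intro p _ i hi
  exact (Multiset.le_sum_of_mem hi).trans (p.parts_sum.le.trans h)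

lemma boundedPartitionCount_zero_zero : boundedPartitionCount 0 0 = 1 := by
  rw [boundedPartitionCount_eq_P le_rfl]
  unfold P
  exact Fintype.card_unique

lemma boundedPartitionCount_zero_succ (k : ℕ) : boundedPartitionCount 0 (k + 1) = 0 := by
  unfold boundedPartitionCount
  rw [Finset.card_eq_zero, Finset.filter_eq_empty_iff]
  intro p _ h
  have h0 : p.parts.sum = 0 := Multiset.sum_eq_zero fun i hi => Nat.le_zero.mp (h i hi)
  have := p.parts_sum
  omega

lemma boundedPartitionCount_succ_of_lt {u k : ℕ} (h : k < u + 1) :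
    boundedPartitionCount (u + 1) k = boundedPartitionCount u k := by
  rw [boundedPartitionCount_eq_P h.le, boundedPartitionCount_eq_P (Nat.lt_succ_iff.mp h)]

lemma boundedPartitionCount_succ_add (u k : ℕ) :
    boundedPartitionCount (u + 1) (k + (u + 1)) =
      boundedPartitionCount u (k + (u + 1)) + boundedPartitionCount (u + 1) k := by
  unfold boundedPartitionCount
  rw [← Finset.card_filter_add_card_filter_not (fun p : Nat.Partition (k + (u + 1)) =>
    u + 1 ∉ p.parts), Finset.filter_filter, Finset.filter_filter]
  congr 1
  · congr 1
    ext p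
    simp only [Finset.mem_filter, Finset.mem_univ, true_and]
    constructor
    · rintro ⟨h, hu⟩ i hi
      have := h i hi
      rcases this.lt_or_eq with h1 | rfl
      · omega
      · exact absurd hi hu
    · intro h
      exact ⟨fun i hi => (h i hi).trans (Nat.le_succ u), fun hu => by have := h _ hu; omega⟩
  · refine Finset.card_bij'
      (fun p hp => ⟨p.parts.erase (u + 1),
        fun hi => p.parts_pos (Multiset.mem_of_mem_erase hi), ?_⟩)
      (fun p _ => ⟨(u + 1) ::ₘ p.parts, ?_, ?_⟩) ?_ ?_ ?_ ?_
    · have hm : u + 1 ∈ p.parts := by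
        simpa using (Finset.mem_filter.mp hp).2.2
      have h1 := congrArg Multiset.sum (Multiset.cons_erase hm)
      rw [Multiset.sum_cons, p.parts_sum] at h1
      omega
    · intro i hi
      rcases Multiset.mem_cons.mp hi with rfl | hi
      · exact Nat.succ_pos u
      · exact p.parts_pos hi
    · rw [Multiset.sum_cons, p.parts_sum, add_comm]
    · intro p hp
      simp only [Finset.mem_filter, Finset.mem_univ, true_and] at hp ⊢
      exact fun i hi => hp.1 i (Multiset.mem_of_mem_erase hi)
    · intro p hp
      simp only [Finset.mem_filter, Finset.mem_univ, true_and] at hp ⊢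
      refine ⟨fun i hi => ?_, by simp⟩
      rcases Multiset.mem_cons.mp hi with rfl | hi
      · exact le_rfl
      · exact hp i hi
    · intro p hp
      simp only [Finset.mem_filter, Finset.mem_univ, true_and, not_not] at hp
      exact Nat.Partition.ext (Multiset.cons_erase hp.2)
    · intro p _
      exact Nat.Partition.ext (Multiset.erase_cons_head _ _)

lemma sum_boundedPartitionCount_succ_le {x : ℝ} (hx0 : 0 ≤ x) (u K : ℕ) :
    ∑ k ∈ range K, (boundedPartitionCount (u + 1) k : ℝ) * x ^ k ≤
      ∑ k ∈ range K, (boundedPartitionCount u k : ℝ) * x ^ k +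
        x ^ (u + 1) * ∑ k ∈ range K, (boundedPartitionCount (u + 1) k : ℝ) * x ^ k := by
  rcases le_total K (u + 1) with h | h
  · have : ∑ k ∈ range K, (boundedPartitionCount (u + 1) k : ℝ) * x ^ k =
        ∑ k ∈ range K, (boundedPartitionCount u k : ℝ) * x ^ k :=
      Finset.sum_congr rfl fun k hk => by
        rw [boundedPartitionCount_succ_of_lt ((Finset.mem_range.mp hk).trans_le h)]
    rw [this]
    exact le_add_of_nonneg_right (by positivity)
  · obtain ⟨r, rfl⟩ := Nat.exists_eq_add_of_le h
    have hsub : ∑ k ∈ range r, (boundedPartitionCount (u + 1) k : ℝ) * x ^ k ≤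
        ∑ k ∈ range (u + 1 + r), (boundedPartitionCount (u + 1) k : ℝ) * x ^ k :=
      Finset.sum_le_sum_of_subset_of_nonneg (Finset.range_subset_range.mpr (by omega))
        (fun _ _ _ => by positivity)
    refine le_trans (le_of_eq ?_) (add_le_add_right (mul_le_mul_of_nonneg_left hsub (by positivity)) _)
    rw [Finset.sum_range_add, Finset.sum_range_add _ (u + 1) r, Finset.mul_sum, add_assoc,
      ← Finset.sum_add_distrib]
    congr 1
    · exact Finset.sum_congr rfl fun k hk => by
        rw [boundedPartitionCount_succ_of_lt (Finset.mem_range.mp hk)]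
    · refine Finset.sum_congr rfl fun k _ => ?_
      rw [add_comm (u + 1) k, boundedPartitionCount_succ_add, pow_add]
      push_cast
      ring

lemma sum_boundedPartitionCount_le {x : ℝ} (hx0 : 0 ≤ x) (hx1 : x < 1) (u K : ℕ) :
    ∑ k ∈ range K, (boundedPartitionCount u k : ℝ) * x ^ k ≤
      Real.exp ((1 - x)⁻¹ * ∑ i ∈ range u, x ^ (i + 1)) := by
  induction u with
  | zero =>
    cases K with
    | zero => simp
    | succ K =>
      rw [Finset.sum_range_succ']
      simp [boundedPartitionCount_zero_succ, boundedPartitionCount_zero_zero]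
  | succ u ih =>
    have h1x : 0 < 1 - x := by linarith
    have hpow : x ^ (u + 1) ≤ x := by
      simpa using pow_le_pow_of_le_one hx0 hx1.le (Nat.succ_le_succ (Nat.zero_le u))
    have hrec := sum_boundedPartitionCount_succ_le hx0 u K
    set T := ∑ k ∈ range K, (boundedPartitionCount (u + 1) k : ℝ) * x ^ k
    set y := x ^ (u + 1)
    have hy0 : 0 ≤ y := by positivity
    have hy1 : 0 < 1 - y := by linarith
    have hinv : (1 - y)⁻¹ ≤ Real.exp ((1 - x)⁻¹ * y) := by
      have h1 : (1 - y)⁻¹ = 1 + (1 - y)⁻¹ * y := by field_simp; ring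
      have h2 : (1 - y)⁻¹ * y ≤ (1 - x)⁻¹ * y :=
        mul_le_mul_of_nonneg_right (inv_anti₀ h1x (by linarith)) hy0
      rw [h1]
      linarith [Real.add_one_le_exp ((1 - x)⁻¹ * y)]
    have hT : T ≤ (∑ k ∈ range K, (boundedPartitionCount u k : ℝ) * x ^ k) * (1 - y)⁻¹ := by
      rw [← div_eq_mul_inv, le_div_iff₀ hy1]
      linarith
    rw [Finset.sum_range_succ, mul_add, Real.exp_add]
    exact hT.trans (mul_le_mul ih hinv (by positivity) (by positivity))

lemma summable_P_mul_pow {x : ℝ} (hx0 : 0 ≤ x) (hx1 : x < 1) :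
    Summable fun k => (P k : ℝ) * x ^ k := by
  have hs : Summable fun i => x ^ (i + 1) :=
    (summable_nat_add_iff 1).mpr (summable_geometric_of_lt_one hx0 hx1)
  refine summable_of_sum_range_le (c := Real.exp ((1 - x)⁻¹ * ∑' i, x ^ (i + 1)))
    (fun k => by positivity) fun K => ?_
  have : ∑ k ∈ range K, (P k : ℝ) * x ^ k =
      ∑ k ∈ range K, (boundedPartitionCount K k : ℝ) * x ^ k :=
    Finset.sum_congr rfl fun k hk => by
      rw [boundedPartitionCount_eq_P (Finset.mem_range.mp hk).le]
  rw [this]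
  refine (sum_boundedPartitionCount_le hx0 hx1 K K).trans (Real.exp_le_exp.mpr ?_)
  have h1x : 0 ≤ (1 - x)⁻¹ := inv_nonneg.mpr (by linarith)
  exact mul_le_mul_of_nonneg_left (hs.sum_le_tsum _ fun i _ => by positivity) h1x

lemma summable_boundedPartitionCount_mul_pow {x : ℝ} (hx0 : 0 ≤ x) (hx1 : x < 1) (u : ℕ) :
    Summable fun k => (boundedPartitionCount u k : ℝ) * x ^ k :=
  Summable.of_nonneg_of_le (fun k => by positivity)
    (fun k => mul_le_mul_of_nonneg_right
      (by exact_mod_cast boundedPartitionCount_le_P u k) (by positivity))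
    (summable_P_mul_pow hx0 hx1)

/-- The generating function of partitions with parts at most `u`. -/
def boundedPartitionSum (u : ℕ) (x : ℝ) : ℝ := ∑' k, (boundedPartitionCount u k : ℝ) * x ^ k

lemma boundedPartitionSum_nonneg {x : ℝ} (hx0 : 0 ≤ x) (u : ℕ) : 0 ≤ boundedPartitionSum u x :=
  tsum_nonneg fun k => by positivity

lemma boundedPartitionSum_zero (x : ℝ) : boundedPartitionSum 0 x = 1 := by
  unfold boundedPartitionSum
  rw [tsum_eq_single 0]
  · simp [boundedPartitionCount_zero_zero]
  · intro k hk
    obtain ⟨k, rfl⟩ := Nat.exists_eq_succ_of_ne_zero hk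
    simp [boundedPartitionCount_zero_succ]

lemma boundedPartitionSum_succ {x : ℝ} (hx0 : 0 ≤ x) (hx1 : x < 1) (u : ℕ) :
    boundedPartitionSum (u + 1) x =
      boundedPartitionSum u x + x ^ (u + 1) * boundedPartitionSum (u + 1) x := by
  have hs := summable_boundedPartitionCount_mul_pow hx0 hx1
  have hs' := (summable_nat_add_iff (u + 1)).mpr (hs u)
  have head : ∑ k ∈ range (u + 1), (boundedPartitionCount (u + 1) k : ℝ) * x ^ k =
      ∑ k ∈ range (u + 1), (boundedPartitionCount u k : ℝ) * x ^ k :=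
    Finset.sum_congr rfl fun k hk => by
      rw [boundedPartitionCount_succ_of_lt (Finset.mem_range.mp hk)]
  have tail : ∑' k, (boundedPartitionCount (u + 1) (k + (u + 1)) : ℝ) * x ^ (k + (u + 1)) =
      ∑' k, (boundedPartitionCount u (k + (u + 1)) : ℝ) * x ^ (k + (u + 1)) +
        x ^ (u + 1) * ∑' k, (boundedPartitionCount (u + 1) k : ℝ) * x ^ k := by
    rw [← tsum_mul_left, ← hs'.tsum_add ((hs (u + 1)).mul_left _)]
    refine tsum_congr fun k => ?_
    rw [boundedPartitionCount_succ_add, pow_add]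
    push_cast
    ring
  have split := (hs u).sum_add_tsum_nat_add (u + 1)
  have split' := (hs (u + 1)).sum_add_tsum_nat_add (u + 1)
  unfold boundedPartitionSum
  linarith

lemma rpow_neg_two_mul_natCast {t : ℝ} (ht : 0 ≤ t) (k : ℕ) :
    t ^ (-(2 : ℝ) * k) = (t ^ (-2 : ℝ)) ^ k := by
  rw [Real.rpow_mul ht, Real.rpow_natCast]

lemma boundedPartitionSum_le_C {t : ℝ} (ht : 1 < t) (u : ℕ) :
    boundedPartitionSum u (t ^ (-2 : ℝ)) ≤ C t := by
  have hx0 : 0 ≤ t ^ (-2 : ℝ) := by positivity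
  have hx1 : t ^ (-2 : ℝ) < 1 := Real.rpow_lt_one_of_one_lt_of_neg ht (by norm_num)
  unfold boundedPartitionSum C
  simp_rw [rpow_neg_two_mul_natCast (zero_le_one.trans ht.le)]
  exact (summable_boundedPartitionCount_mul_pow hx0 hx1 u).tsum_le_tsum
    (fun k => mul_le_mul_of_nonneg_right
      (by exact_mod_cast boundedPartitionCount_le_P u k) (by positivity))
    (summable_P_mul_pow hx0 hx1)

/-- The sum of `t ^ area` over the nonnegative paths of length `L` ending at height `m`. -/
def pathSum (t : ℝ) (L m : ℕ) : ℝ :=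
  ∑ w : Fin L → Bool, if height w L = m ∧ ∀ i ≤ L, 0 ≤ height w i then t ^ area w else 0

lemma height_self {L : ℕ} (w : Fin L → Bool) :
    height w L = 2 * ((univ.filter (fun j => w j = true)).card : ℤ) - L := by
  have h : (univ.filter (fun j : Fin L => (j : ℕ) < L)) = univ := by
    ext j; simp
  have hc := Finset.card_filter_add_card_filter_not (s := univ) (fun j => w j = true)
  rw [Finset.card_univ, Fintype.card_fin] at hc
  unfold height
  rw [h, Finset.sum_ite]
  simp only [Finset.sum_const, nsmul_eq_mul]
  push_cast [← hc]
  ring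

lemma M_eq_pathSum (a b : ℕ) (t : ℝ) : M a b t = pathSum t (2 * a + b) b := by
  unfold M pathSum DyckSet
  rw [Finset.sum_filter]
  refine Finset.sum_congr rfl fun w _ => ?_
  have h := height_self w
  congr 1
  rw [eq_iff_iff]
  refine and_congr_left fun _ => ?_
  push_cast at h
  omega

lemma height_snoc_of_le {L : ℕ} (w : Fin L → Bool) (c : Bool) {i : ℕ} (hi : i ≤ L) :
    height (Fin.snoc (α := fun _ => Bool) w c) i = height w i := by
  unfold height
  rw [Finset.sum_filter, Finset.sum_filter, Fin.sum_univ_castSucc]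
  simp [hi]

lemma height_snoc_succ {L : ℕ} (w : Fin L → Bool) (c : Bool) :
    height (Fin.snoc (α := fun _ => Bool) w c) (L + 1) = height w L + if c then 1 else -1 := by
  unfold height
  rw [Finset.sum_filter, Finset.sum_filter, Fin.sum_univ_castSucc]
  simp

lemma area_snoc {L : ℕ} (w : Fin L → Bool) (c : Bool) :
    area (Fin.snoc (α := fun _ => Bool) w c) =
      area w + ((height w L : ℝ) + (if c then 1 else -1) / 2) := by
  unfold area
  rw [Finset.sum_range_succ, height_snoc_succ, height_snoc_of_le w c le_rfl]
  have : ∑ i ∈ range L, ((height (Fin.snoc (α := fun _ => Bool) w c) i +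
      height (Fin.snoc (α := fun _ => Bool) w c) (i + 1) : ℤ) : ℝ) =
      ∑ i ∈ range L, ((height w i + height w (i + 1) : ℤ) : ℝ) :=
    Finset.sum_congr rfl fun i hi => by
      have := Finset.mem_range.mp hi
      rw [height_snoc_of_le w c this.le, height_snoc_of_le w c this]
  rw [this]
  push_cast
  ring

lemma forall_height_snoc_nonneg {L : ℕ} (w : Fin L → Bool) (c : Bool) :
    (∀ i ≤ L + 1, 0 ≤ height (Fin.snoc (α := fun _ => Bool) w c) i) ↔
      (∀ i ≤ L, 0 ≤ height w i) ∧ 0 ≤ height w L + if c then 1 else -1 := by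
  constructor
  · intro h
    refine ⟨fun i hi => ?_, ?_⟩
    · rw [← height_snoc_of_le w c hi]
      exact h i (hi.trans (Nat.le_succ L))
    · rw [← height_snoc_succ]
      exact h _ le_rfl
  · rintro ⟨h, h'⟩ i hi
    rcases Nat.le_succ_iff.mp hi with hi | rfl
    · rw [height_snoc_of_le w c hi]
      exact h i hi
    · rwa [height_snoc_succ]

lemma pathSum_succ_eq (t : ℝ) (L m : ℕ) :
    pathSum t (L + 1) m =
      (∑ w : Fin L → Bool, if height w L + 1 = m ∧ ∀ i ≤ L, 0 ≤ height w i then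
        t ^ (area w + ((height w L : ℝ) + 1 / 2)) else 0) +
      ∑ w : Fin L → Bool, if height w L - 1 = m ∧ ∀ i ≤ L, 0 ≤ height w i then
        t ^ (area w + ((height w L : ℝ) - 1 / 2)) else 0 := by
  unfold pathSum
  rw [← (Fin.snocEquiv (fun _ : Fin (L + 1) => Bool)).sum_comp, Fintype.sum_prod_type,
    Fintype.sum_bool]
  congr 1
  · refine Finset.sum_congr rfl fun w _ => ?_
    have hcond : (height (Fin.snoc (α := fun _ => Bool) w true) (L + 1) = m ∧
        ∀ i ≤ L + 1, 0 ≤ height (Fin.snoc (α := fun _ => Bool) w true) i) ↔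
        (height w L + 1 = m ∧ ∀ i ≤ L, 0 ≤ height w i) := by
      rw [height_snoc_succ, forall_height_snoc_nonneg]
      simp only [if_true]
      exact and_congr (by omega) Iff.rfl |>.trans
        (and_congr_right fun h => and_iff_left (by omega))
    have harea : area (Fin.snoc (α := fun _ => Bool) w true) =
        area w + ((height w L : ℝ) + 1 / 2) := by
      rw [area_snoc]
      simp only [if_true]
    exact if_congr hcond (congrArg (t ^ ·) harea) rfl
  · refine Finset.sum_congr rfl fun w _ => ?_
    have hcond : (height (Fin.snoc (α := fun _ => Bool) w false) (L + 1) = m ∧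
        ∀ i ≤ L + 1, 0 ≤ height (Fin.snoc (α := fun _ => Bool) w false) i) ↔
        (height w L - 1 = m ∧ ∀ i ≤ L, 0 ≤ height w i) := by
      rw [height_snoc_succ, forall_height_snoc_nonneg]
      simp only [Bool.false_eq_true, if_false]
      exact and_congr (by omega) Iff.rfl |>.trans
        (and_congr_right fun h => and_iff_left (by omega))
    have harea : area (Fin.snoc (α := fun _ => Bool) w false) =
        area w + ((height w L : ℝ) - 1 / 2) := by
      rw [area_snoc]
      simp only [Bool.false_eq_true, if_false]
      ring
    exact if_congr hcond (congrArg (t ^ ·) harea) rfl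

lemma pathSum_down (t : ℝ) (ht : 0 < t) (L m : ℕ) :
    (∑ w : Fin L → Bool, if height w L - 1 = m ∧ ∀ i ≤ L, 0 ≤ height w i then
        t ^ (area w + ((height w L : ℝ) - 1 / 2)) else 0) =
      pathSum t L (m + 1) * t ^ ((m : ℝ) + 1 / 2) := by
  unfold pathSum
  rw [Finset.sum_mul]
  refine Finset.sum_congr rfl fun w _ => ?_
  have : height w L - 1 = m ↔ height w L = (m + 1 : ℕ) := by push_cast; omega
  rw [ite_mul, zero_mul]
  refine if_ctx_congr (and_congr_left fun _ => this) (fun h => ?_) fun _ => rfl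
  rw [h.1, ← Real.rpow_add ht]
  congr 1
  push_cast
  ring

lemma pathSum_succ_zero {t : ℝ} (ht : 0 < t) (L : ℕ) :
    pathSum t (L + 1) 0 = pathSum t L 1 * t ^ ((0 : ℝ) + 1 / 2) := by
  have hdown := pathSum_down t ht L 0
  rw [Nat.cast_zero (R := ℝ), zero_add] at hdown
  rw [pathSum_succ_eq, ← hdown]
  refine add_eq_right.mpr (Finset.sum_eq_zero fun w _ => if_neg ?_)
  rintro ⟨h, h'⟩
  have := h' L le_rfl
  push_cast at h
  omega

lemma pathSum_succ_succ {t : ℝ} (ht : 0 < t) (L m : ℕ) :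
    pathSum t (L + 1) (m + 1) = pathSum t L m * t ^ ((m : ℝ) + 1 / 2) +
      pathSum t L (m + 2) * t ^ ((m : ℝ) + 1 + 1 / 2) := by
  rw [pathSum_succ_eq, pathSum_down t ht L (m + 1)]
  push_cast
  congr 1
  unfold pathSum
  rw [Finset.sum_mul]
  refine Finset.sum_congr rfl fun w _ => ?_
  have : height w L + 1 = (m : ℤ) + 1 ↔ height w L = m := by omega
  rw [ite_mul, zero_mul]
  refine if_ctx_congr (and_congr_left fun _ => this) (fun h => ?_) fun _ => rfl
  rw [h.1, ← Real.rpow_add ht]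
  push_cast
  rfl

lemma pathSum_zero (t : ℝ) (m : ℕ) : pathSum t 0 m = if m = 0 then 1 else 0 := by
  unfold pathSum
  rw [Fintype.sum_unique]
  have hh : ∀ (w : Fin 0 → Bool) (i : ℕ), height w i = 0 := fun w i => by simp [height]
  have hm : ((0 : ℤ) = m) ↔ m = 0 := by omega
  simp [hh, area, hm]

lemma pathSum_nonneg {t : ℝ} (ht : 0 < t) (L m : ℕ) : 0 ≤ pathSum t L m :=
  Finset.sum_nonneg fun w _ => by split_ifs <;> positivity

lemma pathSum_eq_zero_of_lt {t : ℝ} (ht : 0 < t) {L m : ℕ} (h : L < m) : pathSum t L m = 0 := by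
  induction L generalizing m with
  | zero => rw [pathSum_zero, if_neg (by omega)]
  | succ L ih =>
    obtain ⟨m, rfl⟩ := Nat.exists_eq_succ_of_ne_zero (by omega : m ≠ 0)
    rw [pathSum_succ_succ ht, ih (by omega), ih (by omega)]
    ring

lemma pathSum_eq_zero_of_odd {t : ℝ} (ht : 0 < t) {L m : ℕ} (h : (L + m) % 2 = 1) :
    pathSum t L m = 0 := by
  induction L generalizing m with
  | zero => rw [pathSum_zero, if_neg (by omega)]
  | succ L ih =>
    cases m with
    | zero => rw [pathSum_succ_zero ht, ih (by omega), zero_mul]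
    | succ m =>
      rw [pathSum_succ_succ ht, ih (by omega), ih (by omega)]
      ring

/-- Symmetry of the transfer operator. -/
lemma sum_pathSum_succ_mul {t : ℝ} (ht : 0 < t) {i k N : ℕ} (hi : i + 1 < N) (hk : k + 1 < N) :
    ∑ m ∈ range (N + 1), pathSum t (i + 1) m * pathSum t k m =
      ∑ m ∈ range (N + 1), pathSum t i m * pathSum t (k + 1) m := by
  have key : ∀ p q : ℕ, p + 1 < N → q + 1 < N →
      ∑ m ∈ range (N + 1), pathSum t (p + 1) m * pathSum t q m =
      ∑ m ∈ range N, pathSum t p m * t ^ ((m : ℝ) + 1 / 2) * pathSum t q (m + 1) +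
      ∑ m ∈ range N, pathSum t p (m + 1) * t ^ ((m : ℝ) + 1 / 2) * pathSum t q m := by
    intro p q hp hq
    obtain ⟨N, rfl⟩ := Nat.exists_eq_succ_of_ne_zero (by omega : N ≠ 0)
    rw [Finset.sum_range_succ', Finset.sum_range_succ' (fun m =>
      pathSum t p (m + 1) * t ^ ((m : ℝ) + 1 / 2) * pathSum t q m) N]
    have : ∑ m ∈ range (N + 1), pathSum t (p + 1) (m + 1) * pathSum t q (m + 1) =
      ∑ m ∈ range (N + 1), pathSum t p m * t ^ ((m : ℝ) + 1 / 2) * pathSum t q (m + 1) +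
      ∑ m ∈ range N, pathSum t p (m + 1 + 1) * t ^ (((m + 1 : ℕ) : ℝ) + 1 / 2) *
        pathSum t q (m + 1) := by
      rw [← add_zero (∑ m ∈ range N, _),
        show (0 : ℝ) = pathSum t p (N + 1 + 1) * t ^ (((N + 1 : ℕ) : ℝ) + 1 / 2) *
          pathSum t q (N + 1) by rw [pathSum_eq_zero_of_lt ht (by omega : p < N + 1 + 1)]; ring,
        ← Finset.sum_range_succ (fun m => pathSum t p (m + 1 + 1) *
          t ^ (((m + 1 : ℕ) : ℝ) + 1 / 2) * pathSum t q (m + 1)), ← Finset.sum_add_distrib]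
      refine Finset.sum_congr rfl fun m _ => ?_
      rw [pathSum_succ_succ ht]
      push_cast
      ring
    rw [this, pathSum_succ_zero ht, Nat.cast_zero]
    ring
  have hcomm : ∑ m ∈ range (N + 1), pathSum t i m * pathSum t (k + 1) m =
      ∑ m ∈ range (N + 1), pathSum t (k + 1) m * pathSum t i m :=
    Finset.sum_congr rfl fun m _ => mul_comm _ _
  rw [hcomm, key i k hi hk, key k i hk hi, add_comm]
  congr 1 <;> exact Finset.sum_congr rfl fun m _ => by ring

lemma sum_pathSum_mul {t : ℝ} (ht : 0 < t) (i k N : ℕ) (hN : i + k + 1 < N) :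
    ∑ m ∈ range (N + 1), pathSum t i m * pathSum t k m = pathSum t (i + k) 0 := by
  induction i generalizing k with
  | zero =>
    rw [Finset.sum_range_succ', pathSum_zero, if_pos rfl, zero_add, one_mul]
    refine add_eq_right.mpr (Finset.sum_eq_zero fun m _ => ?_)
    rw [pathSum_zero, if_neg (by omega), zero_mul]
  | succ i ih =>
    rw [sum_pathSum_succ_mul ht (by omega) (by omega), ih (k + 1) (by omega)]
    congr 1
    omega

/-- Cutting a Dyck path at position `j`. -/
lemma sum_filter_pathSum_mul {t : ℝ} (ht : 0 < t) (j k : ℕ) :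
    ∑ m ∈ (range (j + 1)).filter (fun m => (j - m) % 2 = 0), pathSum t j m * pathSum t k m =
      pathSum t (j + k) 0 := by
  rw [← sum_pathSum_mul ht j k (j + k + 2) (by omega)]
  refine Finset.sum_subset (fun m hm => ?_) fun m _ hm => ?_
  · simp only [Finset.mem_filter, Finset.mem_range] at hm ⊢
    omega
  · simp only [Finset.mem_filter, Finset.mem_range, not_and] at hm
    rcases lt_or_ge j m with h | h
    · rw [pathSum_eq_zero_of_lt ht h, zero_mul]
    · have := hm (by omega)
      rw [pathSum_eq_zero_of_odd ht (by omega), zero_mul]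

lemma pathSum_le {t : ℝ} (ht : 1 < t) (L d m : ℕ) (hL : L = 2 * d + m) :
    pathSum t L m ≤ t ^ (((d : ℝ) + m) ^ 2 - (m : ℝ) ^ 2 / 2) *
      boundedPartitionSum d (t ^ (-2 : ℝ)) := by
  have ht0 : 0 < t := by linarith
  have hx0 : 0 ≤ t ^ (-2 : ℝ) := by positivity
  have hx1 : t ^ (-2 : ℝ) < 1 := Real.rpow_lt_one_of_one_lt_of_neg ht (by norm_num)
  induction L generalizing d m with
  | zero =>
    obtain rfl : d = 0 := by omega
    obtain rfl : m = 0 := by omega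
    simp [pathSum_zero, boundedPartitionSum_zero]
  | succ L ih =>
    rcases m with _ | m
    · obtain ⟨d, rfl⟩ := Nat.exists_eq_succ_of_ne_zero (by omega : d ≠ 0)
      have h := mul_le_mul_of_nonneg_right (ih d 1 (by omega))
        (Real.rpow_nonneg ht0.le ((0 : ℝ) + 1 / 2))
      rw [pathSum_succ_zero ht0]
      refine h.trans ?_
      rw [mul_right_comm, ← Real.rpow_add ht0]
      have hS := boundedPartitionSum_succ hx0 hx1 d
      have := mul_nonneg (pow_nonneg hx0 (d + 1)) (boundedPartitionSum_nonneg hx0 (d + 1))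
      refine mul_le_mul (le_of_eq ?_) (by linarith) (boundedPartitionSum_nonneg hx0 _)
        (by positivity)
      congr 1
      push_cast
      ring
    · rw [pathSum_succ_succ ht0]
      have h1 := mul_le_mul_of_nonneg_right (ih d m (by omega))
        (Real.rpow_nonneg ht0.le ((m : ℝ) + 1 / 2))
      rw [mul_right_comm, ← Real.rpow_add ht0] at h1
      have e1 : ((d : ℝ) + m) ^ 2 - (m : ℝ) ^ 2 / 2 + ((m : ℝ) + 1 / 2) =
          (((d : ℝ) + (m + 1 : ℕ)) ^ 2 - ((m + 1 : ℕ) : ℝ) ^ 2 / 2) + (-2) * (d : ℝ) := by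
        push_cast
        ring
      rw [e1, Real.rpow_add ht0 _ ((-2) * (d : ℝ)), rpow_neg_two_mul_natCast ht0.le] at h1
      rcases d with _ | d
      · rw [pathSum_eq_zero_of_lt ht0 (by omega : L < m + 2)]
        simpa using h1
      · have h2 := mul_le_mul_of_nonneg_right (ih d (m + 2) (by omega))
          (Real.rpow_nonneg ht0.le ((m : ℝ) + 1 + 1 / 2))
        rw [mul_right_comm, ← Real.rpow_add ht0] at h2
        have e2 : ((d : ℝ) + (m + 2 : ℕ)) ^ 2 - ((m + 2 : ℕ) : ℝ) ^ 2 / 2 +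
            ((m : ℝ) + 1 + 1 / 2) =
            ((d + 1 : ℕ) + ((m + 1 : ℕ) : ℝ)) ^ 2 - ((m + 1 : ℕ) : ℝ) ^ 2 / 2 := by
          push_cast
          ring
        rw [e2] at h2
        rw [boundedPartitionSum_succ hx0 hx1 d]
        linarith

lemma le_pathSum {t : ℝ} (ht : 0 < t) (L d m : ℕ) (hL : L = 2 * d + m) :
    t ^ (((d : ℝ) + m) ^ 2 - (m : ℝ) ^ 2 / 2) ≤ pathSum t L m := by
  induction L generalizing d m with
  | zero =>
    obtain rfl : d = 0 := by omega
    obtain rfl : m = 0 := by omega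
    simp [pathSum_zero]
  | succ L ih =>
    rcases d with _ | d
    · obtain ⟨m, rfl⟩ := Nat.exists_eq_succ_of_ne_zero (by omega : m ≠ 0)
      have h := mul_le_mul_of_nonneg_right (ih 0 m (by omega))
        (Real.rpow_nonneg ht.le ((m : ℝ) + 1 / 2))
      rw [← Real.rpow_add ht] at h
      rw [Nat.succ_eq_add_one, pathSum_succ_succ ht]
      have h0 := mul_nonneg (pathSum_nonneg ht L (m + 2))
        (Real.rpow_nonneg ht.le ((m : ℝ) + 1 + 1 / 2))
      refine le_trans (le_of_eq ?_) (h.trans (le_add_of_nonneg_right h0))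
      congr 1
      push_cast
      ring
    · have h := mul_le_mul_of_nonneg_right (ih d (m + 1) (by omega))
        (Real.rpow_nonneg ht.le ((m : ℝ) + 1 / 2))
      rw [← Real.rpow_add ht] at h
      have e : ((d : ℝ) + (m + 1 : ℕ)) ^ 2 - ((m + 1 : ℕ) : ℝ) ^ 2 / 2 + ((m : ℝ) + 1 / 2) =
          ((d + 1 : ℕ) + (m : ℝ)) ^ 2 - (m : ℝ) ^ 2 / 2 := by
        push_cast
        ring
      rw [e] at h
      refine h.trans ?_
      rcases m with _ | m
      · rw [pathSum_succ_zero ht, Nat.cast_zero]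
      · rw [pathSum_succ_succ ht]
        have h0 := mul_nonneg (pathSum_nonneg ht L m)
          (Real.rpow_nonneg ht.le ((m : ℝ) + 1 / 2))
        push_cast
        exact le_add_of_nonneg_left h0

lemma Mlm_eq_pathSum {l m : ℕ} (h : m ≤ l) (hpar : (l - m) % 2 = 0) (t : ℝ) :
    Mlm l m t = pathSum t l m := by
  unfold Mlm
  rw [M_eq_pathSum]
  congr 1
  omega

lemma summable_natCast_mul_rpow {t : ℝ} (ht : 1 < t) {c : ℝ} (hc : 0 ≤ c) :
    Summable fun N : ℕ => (N : ℝ) * t ^ (-(2 : ℝ) * N ^ 2 - c * N) := by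
  have hx0 : 0 ≤ t ^ (-2 : ℝ) := by positivity
  have hx1 : t ^ (-2 : ℝ) < 1 := Real.rpow_lt_one_of_one_lt_of_neg ht (by norm_num)
  have hs := summable_pow_mul_geometric_of_norm_lt_one 1
    (r := t ^ (-2 : ℝ)) (by rwa [Real.norm_of_nonneg hx0])
  refine Summable.of_nonneg_of_le (fun N => by positivity) (fun N => ?_) hs
  rw [pow_one, ← rpow_neg_two_mul_natCast (by linarith)]
  refine mul_le_mul_of_nonneg_left (Real.rpow_le_rpow_of_exponent_le ht.le ?_) (by positivity)
  have h1 : (N : ℝ) ≤ (N : ℝ) ^ 2 := by exact_mod_cast Nat.le_self_pow two_ne_zero N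
  have h2 : 0 ≤ c * N := by positivity
  linarith

lemma pathSum_mul_pathSum_div_le {t : ℝ} (ht : 1 < t) {n j N : ℕ} (hjn : j ≤ n)
    (hN : 2 * N ≤ j) :
    pathSum t j (j - 2 * N) * pathSum t (2 * n - j) (j - 2 * N) / pathSum t (2 * n) 0 ≤
      C t ^ 2 * t ^ (-(2 : ℝ) * N ^ 2 - 2 * (n - j : ℕ) * N) := by
  have ht0 : 0 < t := by linarith
  obtain ⟨m, rfl⟩ := Nat.exists_eq_add_of_le hN
  obtain ⟨r, rfl⟩ := Nat.exists_eq_add_of_le hjn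
  have hC0 : 0 ≤ C t :=
    (boundedPartitionSum_nonneg (by positivity) 0).trans (boundedPartitionSum_le_C ht 0)
  have hle : ∀ L d : ℕ, L = 2 * d + m →
      pathSum t L m ≤ t ^ (((d : ℝ) + m) ^ 2 - (m : ℝ) ^ 2 / 2) * C t := fun L d h =>
    (pathSum_le ht L d m h).trans
      (mul_le_mul_of_nonneg_left (boundedPartitionSum_le_C ht d) (by positivity))
  have h1 := hle (2 * N + m) N rfl
  have h2 := hle (2 * (2 * N + m + r) - (2 * N + m)) (N + r) (by omega)
  have h3 := le_pathSum ht0 (2 * (2 * N + m + r)) (2 * N + m + r) 0 rfl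
  have hpos := (Real.rpow_pos_of_pos ht0 _).trans_le h3
  have e1 : 2 * N + m - 2 * N = m := by omega
  have e2 : 2 * N + m + r - (2 * N + m) = r := by omega
  rw [e1, e2, div_le_iff₀ hpos]
  refine (mul_le_mul h1 h2 (pathSum_nonneg ht0 _ _) (by positivity)).trans ?_
  refine le_trans (le_of_eq ?_) (mul_le_mul_of_nonneg_left h3 (by positivity))
  rw [mul_mul_mul_comm, ← Real.rpow_add ht0, mul_assoc (C t ^ 2), ← Real.rpow_add ht0, mul_comm,
    sq (C t)]
  congr 2
  push_cast
  ring

/-- Mean height at the cut `j`: `0 ≤ j - ⟨m_j⟩ < 2 C(t)² Σ_{N'} N' t^{-2N'²-2(n-j)N'}`,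
and in particular `j - ⟨m_j⟩ < 2 C(t)² Σ_{N'} N' t^{-2N'²}`. -/
theorem stmt_10 (t : ℝ) (ht : 1 < t) (n j : ℕ) (hn : 1 ≤ n) (hj1 : 1 ≤ j) (hjn : j ≤ n) :
    let mj := ∑ m ∈ (Finset.range (j + 1)).filter (fun m => (j - m) % 2 = 0),
      (m : ℝ) * Mlm j m t * Mlm (2 * n - j) m t / Mlm (2 * n) 0 t
    0 ≤ (j : ℝ) - mj ∧
    (j : ℝ) - mj <
      2 * C t ^ 2 * ∑' N' : ℕ, (N' : ℝ) * t ^ (-(2 : ℝ) * N' ^ 2 - 2 * (n - j : ℕ) * N') ∧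
    (j : ℝ) - mj < 2 * C t ^ 2 * ∑' N' : ℕ, (N' : ℝ) * t ^ (-(2 : ℝ) * N' ^ 2) := by
  intro mj
  have ht0 : 0 < t := by linarith
  set s := (Finset.range (j + 1)).filter (fun m => (j - m) % 2 = 0) with hs
  have hmem : ∀ m ∈ s, m ≤ j ∧ (j - m) % 2 = 0 := fun m hm => by
    simp only [hs, Finset.mem_filter, Finset.mem_range] at hm
    omega
  have hpos : 0 < pathSum t (2 * n) 0 :=
    (Real.rpow_pos_of_pos ht0 _).trans_le (le_pathSum ht0 (2 * n) n 0 rfl)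
  have hcut : ∑ m ∈ s, pathSum t j m * pathSum t (2 * n - j) m / pathSum t (2 * n) 0 = 1 := by
    rw [← Finset.sum_div, hs, sum_filter_pathSum_mul ht0, Nat.add_sub_cancel' (by omega),
      div_self hpos.ne']
  have hdiff : (j : ℝ) - mj = ∑ m ∈ s,
      ((j : ℝ) - m) * (pathSum t j m * pathSum t (2 * n - j) m / pathSum t (2 * n) 0) := by
    have hmj : mj = ∑ m ∈ s,
        (m : ℝ) * (pathSum t j m * pathSum t (2 * n - j) m / pathSum t (2 * n) 0) := by
      refine Finset.sum_congr rfl fun m hm => ?_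
      obtain ⟨h1, h2⟩ := hmem m hm
      rw [Mlm_eq_pathSum h1 h2, Mlm_eq_pathSum (by omega) (by omega),
        Mlm_eq_pathSum (Nat.zero_le _) (by omega)]
      ring
    simp only [sub_mul, Finset.sum_sub_distrib]
    rw [hmj, ← Finset.mul_sum, hcut, mul_one]
  set g : ℕ → ℝ := fun N => (N : ℝ) * t ^ (-(2 : ℝ) * N ^ 2 - 2 * (n - j : ℕ) * N) with hg
  have hg0 : ∀ N, 0 ≤ g N := fun N => by positivity
  have hgs : Summable g := summable_natCast_mul_rpow ht (by positivity)
  have hC : 0 < C t := by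
    have := boundedPartitionSum_le_C ht 0
    rw [boundedPartitionSum_zero] at this
    linarith
  have hterm : ∀ m ∈ s,
      ((j : ℝ) - m) * (pathSum t j m * pathSum t (2 * n - j) m / pathSum t (2 * n) 0) ≤
        2 * C t ^ 2 * g ((j - m) / 2) := by
    intro m hm
    obtain ⟨h1, h2⟩ := hmem m hm
    have hm' : m = j - 2 * ((j - m) / 2) := by omega
    have hle := pathSum_mul_pathSum_div_le ht hjn (N := (j - m) / 2) (by omega)
    rw [← hm'] at hle
    have hc : (j : ℝ) - m = 2 * ((j - m) / 2 : ℕ) := by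
      rw [← Nat.cast_sub h1]
      exact_mod_cast (by omega : j - m = 2 * ((j - m) / 2))
    rw [hc]
    refine (mul_le_mul_of_nonneg_left hle (by positivity)).trans (le_of_eq ?_)
    simp only [hg]
    ring
  have hsum : ∑ m ∈ s, g ((j - m) / 2) < ∑' N, g N := by
    rw [← Finset.sum_image (f := g) (g := fun m => (j - m) / 2)]
    · have hj : j + 1 ∉ s.image (fun m => (j - m) / 2) := by
        simp only [Finset.mem_image, not_exists, not_and]
        omega
      refine lt_of_lt_of_le ?_ (hgs.sum_le_tsum (insert (j + 1) (s.image fun m => (j - m) / 2)) fun N _ => hg0 N)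
      rw [Finset.sum_insert hj]
      exact lt_add_of_pos_left _ (by positivity)
    · intro a ha b hb hab
      have := hmem a ha
      have := hmem b hb
      simp only at hab
      omega
  have hmain : (j : ℝ) - mj < 2 * C t ^ 2 * ∑' N, g N := by
    rw [hdiff]
    refine (Finset.sum_le_sum hterm).trans_lt ?_
    rw [← Finset.mul_sum]
    exact mul_lt_mul_of_pos_left hsum (by positivity)
  refine ⟨?_, hmain, hmain.trans_le ?_⟩
  · rw [hdiff]
    refine Finset.sum_nonneg fun m hm => mul_nonneg ?_ ?_
    · exact sub_nonneg.mpr (by exact_mod_cast (hmem m hm).1)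
    · exact div_nonneg (mul_nonneg (pathSum_nonneg ht0 _ _) (pathSum_nonneg ht0 _ _)) hpos.le
  · refine mul_le_mul_of_nonneg_left (hgs.tsum_le_tsum (fun N => ?_) ?_) (by positivity)
    · refine mul_le_mul_of_nonneg_left (Real.rpow_le_rpow_of_exponent_le ht.le ?_) (by positivity)
      exact sub_le_self _ (by positivity)
    · simpa using summable_natCast_mul_rpow ht le_rfl
end
end
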